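/- Let X ⊆ I₂ be a set of permutations, let β ∈ I₂ ∩ Av(X), and suppose that C = I₂ ∩ Av(X) ∩ Av(β) is an infinite class. Then C and C' = I₂ ∩ Av(X) ∩ Av(1 ⊕ β) have the same growth rate: s(C) = s(C'). -/

import Mathlib

open Filter

/-- `f` is an embedding (involvement) of the permutation `α` into the permutation `π`:
it is strictly monotone on positions and preserves the relative order of values. -/
def IsEmbedding {m n : ℕ} (α : Equiv.Perm (Fin m)) (π : Equiv.Perm (Fin n))
    (f : Fin m → Fin n) : Prop :=
  StrictMono f ∧ ∀ a b : Fin m, α a < α b ↔ π (f a) < π (f b)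

/-- A permutation of arbitrary (finite) length. -/
abbrev PermSig := Σ n : ℕ, Equiv.Perm (Fin n)

/-- `α ≼ π`: the pattern `α` is involved in `π`. -/
def Involves (α π : PermSig) : Prop := ∃ f, IsEmbedding α.2 π.2 f

/-- The class of permutations avoiding every pattern in `X`. -/
def AvClass (X : Set PermSig) : Set PermSig := {π | ∀ α ∈ X, ¬ Involves α π}

/-- A pattern class: a set of permutations closed downward under involvement. -/
def IsPatternClass (C : Set PermSig) : Prop :=
  ∀ α π : PermSig, Involves α π → π ∈ C → α ∈ C

/-- The number of permutations of length `n` in `C`. -/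
noncomputable def classCount (C : Set PermSig) (n : ℕ) : ℕ :=
  Nat.card {π : Equiv.Perm (Fin n) // (⟨n, π⟩ : PermSig) ∈ C}

/-- The (upper) growth rate `s(C) = limsup |C ∩ S_n|^{1/n}`, valued in `ℝ≥0∞`. -/
noncomputable def growthRate (C : Set PermSig) : ENNReal :=
  Filter.atTop.limsup fun n : ℕ => (classCount C n : ENNReal) ^ (1 / (n : ℝ))

/-- `π` contains a decreasing subsequence of length `k`. -/
def HasDecSeq {n : ℕ} (π : Equiv.Perm (Fin n)) (k : ℕ) : Prop :=
  ∃ q : Fin k → Fin n, StrictMono q ∧ StrictAnti fun i => π (q i)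

/-- The class `I_k = Av(δ_{k+1})` of permutations with no decreasing
subsequence of length `k+1`. -/
def IkClass (k : ℕ) : Set PermSig := {π | ¬ HasDecSeq π.2 (k + 1)}

/-- `f` and `g` witness `π` as a merge of `α` and `β`: both are embeddings and
their ranges partition the points of `π`. -/
def IsMergeVia {a b n : ℕ} (α : Equiv.Perm (Fin a)) (β : Equiv.Perm (Fin b))
    (π : Equiv.Perm (Fin n)) (f : Fin a → Fin n) (g : Fin b → Fin n) : Prop :=
  IsEmbedding α π f ∧ IsEmbedding β π g ∧ ∀ x : Fin n, (∃ i, f i = x) ↔ ¬∃ j, g j = x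

/-- The merge `M(C, D)` of two sets of permutations. -/
def MergeClass (C D : Set PermSig) : Set PermSig :=
  {π | ∃ α ∈ C, ∃ β ∈ D, ∃ f g, IsMergeVia α.2 β.2 π.2 f g}

/-- Number of indices `c` with `c+1 < n` such that exactly one of the points
`c`, `c+1` lies in `S`. -/
noncomputable def posChanges {n : ℕ} (S : Set (Fin n)) : ℕ :=
  Set.ncard {c : Fin n | ∃ h : (c : ℕ) + 1 < n, ¬ (c ∈ S ↔ (⟨(c : ℕ) + 1, h⟩ : Fin n) ∈ S)}

/-- Total number of type changes, by position and by value, of the merge of `π`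
whose first part occupies the set of positions `S`. -/
noncomputable def typeChanges {n : ℕ} (π : Equiv.Perm (Fin n)) (S : Set (Fin n)) : ℕ :=
  posChanges S + posChanges ((fun x => π x) '' S)

/-- The `B`-bounded merge `M_B(C, D)`: merges of a member of `C` with a member of
`D` having at most `B` type changes in total, by position or by value. -/
def BMergeClass (B : ℕ) (C D : Set PermSig) : Set PermSig :=
  {π | ∃ α ∈ C, ∃ β ∈ D, ∃ f g, IsMergeVia α.2 β.2 π.2 f g ∧
    typeChanges π.2 (Set.range f) ≤ B}

/-- The direct sum of two permutations. -/
def dsum {a b : ℕ} (α : Equiv.Perm (Fin a)) (β : Equiv.Perm (Fin b)) :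
    Equiv.Perm (Fin (a + b)) :=
  finSumFinEquiv.symm.trans ((Equiv.sumCongr α β).trans finSumFinEquiv)

/-- The direct sum `α ⊕ β` of two permutations of arbitrary lengths. -/
def DSum (α β : PermSig) : PermSig := ⟨α.1 + β.1, dsum α.2 β.2⟩

/-- The increasing permutation `ι_m` of length `m`. -/
def iotaSig (m : ℕ) : PermSig := ⟨m, 1⟩

/-- The direct sum of a list of permutations. -/
def DSumList (l : List PermSig) : PermSig := l.foldr DSum (iotaSig 0)

/-- A (nonempty) permutation that is not the direct sum of two nonempty permutations. -/
def PlusIndec (ρ : PermSig) : Prop :=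
  ρ.1 ≠ 0 ∧ ∀ α β : PermSig, α.1 ≠ 0 → β.1 ≠ 0 → ρ ≠ DSum α β

/-- `ρ = red(π)`: writing `π = ι_{m₀} ⊕ ρ₁ ⊕ ι_{m₁} ⊕ ⋯ ⊕ ρ_c ⊕ ι_{m_c}` with each
`ρ_i` plus indecomposable of length at least 2, the rigid reduction of `π` is
`ρ = ρ₁ ⊕ ⋯ ⊕ ρ_c`. -/
def IsRigidReductionOf (ρ π : PermSig) : Prop :=
  ∃ (m₀ : ℕ) (pairs : List (PermSig × ℕ)),
    (∀ p ∈ pairs, PlusIndec p.1 ∧ 2 ≤ p.1.1) ∧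
    π = DSum (iotaSig m₀) (DSumList (pairs.map fun p => DSum p.1 (iotaSig p.2))) ∧
    ρ = DSumList (pairs.map Prod.fst)


theorem IsEmbedding.trans' {a b c : ℕ} {α : Equiv.Perm (Fin a)} {β : Equiv.Perm (Fin b)}
    {γ : Equiv.Perm (Fin c)} {f : Fin a → Fin b} {g : Fin b → Fin c}
    (hf : IsEmbedding α β f) (hg : IsEmbedding β γ g) : IsEmbedding α γ (g ∘ f) :=
  ⟨hg.1.comp hf.1, fun x y => (hf.2 x y).trans (hg.2 _ _)⟩

theorem Involves.trans' {α β γ : PermSig} (h1 : Involves α β) (h2 : Involves β γ) :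
    Involves α γ := by
  obtain ⟨f, hf⟩ := h1
  obtain ⟨g, hg⟩ := h2
  exact ⟨g ∘ f, hf.trans' hg⟩

theorem isPatternClass_Ik (k : ℕ) : IsPatternClass (IkClass k) := by
  rintro α π ⟨f, hf⟩ hπ ⟨q, hq1, hq2⟩
  refine hπ ⟨f ∘ q, hf.1.comp hq1, ?_⟩
  intro i j hij
  exact (hf.2 _ _).1 (hq2 hij)

theorem isPatternClass_Av (X : Set PermSig) : IsPatternClass (AvClass X) := by
  intro α π h hπ x hx hxα
  exact hπ x hx (hxα.trans' h)

theorem dsum_castAdd {a b : ℕ} (α : Equiv.Perm (Fin a)) (β : Equiv.Perm (Fin b)) (i : Fin a) :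
    dsum α β (Fin.castAdd b i) = Fin.castAdd b (α i) := by
  simp [dsum]

theorem dsum_natAdd {a b : ℕ} (α : Equiv.Perm (Fin a)) (β : Equiv.Perm (Fin b)) (i : Fin b) :
    dsum α β (Fin.natAdd a i) = Fin.natAdd a (β i) := by
  simp [dsum]

theorem involves_dsum_right (α β : PermSig) : Involves β (DSum α β) := by
  have h : IsEmbedding β.2 (dsum α.2 β.2) (Fin.natAdd α.1) := by
    refine ⟨Fin.strictMono_natAdd _, ?_⟩
    intro i j
    rw [dsum_natAdd, dsum_natAdd]
    simp
  exact ⟨_, h⟩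

theorem involves_oneSum {n : ℕ} (β : PermSig) (π : Equiv.Perm (Fin n)) (f : Fin β.1 → Fin n)
    (hf : IsEmbedding β.2 π f) (m : Fin n) (h1 : ∀ i, m < f i) (h2 : ∀ i, π m < π (f i)) :
    Involves (DSum (iotaSig 1) β) ⟨n, π⟩ := by
  have key : IsEmbedding (dsum (1 : Equiv.Perm (Fin 1)) β.2) π
      (fun i => Fin.addCases (m := 1) (n := β.1) (fun _ => m) f i) := by
    refine ⟨?_, ?_⟩
    · intro i j
      induction i using Fin.addCases <;> induction j using Fin.addCases
      · intro h
        exfalso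
        simp only [Fin.lt_def, Fin.val_castAdd] at h
        omega
      · intro h
        simp only [Fin.addCases_left, Fin.addCases_right]
        exact h1 _
      · intro h
        exfalso
        simp only [Fin.lt_def, Fin.val_castAdd, Fin.val_natAdd] at h
        omega
      · intro h
        simp only [Fin.addCases_right]
        apply hf.1
        simp only [Fin.lt_def, Fin.val_natAdd] at h ⊢
        omega
    · intro i j
      induction i using Fin.addCases <;> induction j using Fin.addCases
      · simp [dsum_castAdd, Fin.lt_def]
      · simp only [dsum_castAdd, dsum_natAdd, Fin.addCases_left, Fin.addCases_right, h2, iff_true]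
        simp only [Fin.lt_def, Fin.val_castAdd, Fin.val_natAdd]
        omega
      · simp only [dsum_castAdd, dsum_natAdd, Fin.addCases_left, Fin.addCases_right,
          (h2 _).not_gt, iff_false]
        simp only [Fin.lt_def, Fin.val_castAdd, Fin.val_natAdd]
        omega
      · simp only [dsum_natAdd, Fin.addCases_right]
        rw [← hf.2]
        simp
  exact ⟨_, key⟩

/-! ### The cut -/

theorem exists_lines {n : ℕ} (π : Equiv.Perm (Fin n)) (p v : ℕ) (x0 x1 : Fin n)
    (hx0 : x0.val < p) (hx0v : v ≤ (π x0).val) (hx1 : (π x1).val < v) (hx1p : p ≤ x1.val) :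
    ∃ P V : ℕ → ℕ, P 0 = 0 ∧ V 0 = 0 ∧ P 1 = p ∧ V 1 = v ∧ Monotone P ∧ Monotone V ∧
      (∀ i x, (π x).val < V i → x.val < P (i + 1)) ∧
      (∀ i (x : Fin n), x.val < P i → (π x).val < V (i + 1)) ∧
      (∀ i y, 1 ≤ i → y < P (i + 1) → ∃ x : Fin n, (π x).val < V i ∧ y ≤ x.val) ∧
      (∀ i y, 1 ≤ i → y < V (i + 1) → ∃ x : Fin n, x.val < P i ∧ y ≤ (π x).val) := by
  classical
  let F : ℕ → ℕ := fun w => (Finset.univ.filter (fun x => (π x).val < w)).sup (fun x => x.val + 1)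
  let G : ℕ → ℕ := fun w => (Finset.univ.filter (fun x : Fin n => x.val < w)).sup
    (fun x => (π x).val + 1)
  have hF : Monotone F := by
    intro a b hab
    apply Finset.sup_mono
    intro x
    simp only [Finset.mem_filter, Finset.mem_univ, true_and]
    omega
  have hG : Monotone G := by
    intro a b hab
    apply Finset.sup_mono
    intro x
    simp only [Finset.mem_filter, Finset.mem_univ, true_and]
    omega
  let step : ℕ × ℕ → ℕ × ℕ := fun q => (F q.2, G q.1)
  let Z : ℕ → ℕ × ℕ := fun i => step^[i] (p, v)
  have hZ : ∀ i, Z (i + 1) = step (Z i) := fun i => Function.iterate_succ_apply' _ _ _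
  have hF1 : ∀ w (x : Fin n), (π x).val < w → x.val < F w := by
    intro w x hx
    have : x.val + 1 ≤ F w := Finset.le_sup (f := fun x : Fin n => x.val + 1) (by simpa using hx)
    omega
  have hG1 : ∀ w (x : Fin n), x.val < w → (π x).val < G w := by
    intro w x hx
    have : (π x).val + 1 ≤ G w :=
      Finset.le_sup (f := fun x : Fin n => (π x).val + 1) (by simpa using hx)
    omega
  have hF2 : ∀ w y, y < F w → ∃ x : Fin n, (π x).val < w ∧ y ≤ x.val := by
    intro w y hy
    obtain ⟨x, hx, hxy⟩ := (Finset.lt_sup_iff).1 hy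
    exact ⟨x, by simpa using hx, by omega⟩
  have hG2 : ∀ w y, y < G w → ∃ x : Fin n, x.val < w ∧ y ≤ (π x).val := by
    intro w y hy
    obtain ⟨x, hx, hxy⟩ := (Finset.lt_sup_iff).1 hy
    exact ⟨x, by simpa using hx, by omega⟩
  have hmono : ∀ i, (Z i).1 ≤ (Z (i + 1)).1 ∧ (Z i).2 ≤ (Z (i + 1)).2 := by
    intro i
    induction i with
    | zero =>
      have a := hF1 v x1 hx1
      have b := hG1 p x0 hx0
      change p ≤ F v ∧ v ≤ G p
      omega
    | succ i ih =>
      rw [hZ (i + 1)]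
      nth_rewrite 1 [hZ i]
      nth_rewrite 2 [hZ i]
      exact ⟨hF ih.2, hG ih.1⟩
  refine ⟨fun i => Nat.casesOn i 0 (fun i => (Z i).1), fun i => Nat.casesOn i 0 (fun i => (Z i).2),
    rfl, rfl, rfl, rfl, ?_, ?_, ?_, ?_, ?_, ?_⟩
  · apply monotone_nat_of_le_succ
    rintro (_ | i)
    · exact Nat.zero_le _
    · exact (hmono i).1
  · apply monotone_nat_of_le_succ
    rintro (_ | i)
    · exact Nat.zero_le _
    · exact (hmono i).2
  · rintro (_ | i) x hx
    · exact absurd hx (Nat.not_lt_zero _)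
    · simp only [hZ]
      exact hF1 _ _ hx
  · rintro (_ | i) x hx
    · exact absurd hx (Nat.not_lt_zero _)
    · simp only [hZ]
      exact hG1 _ _ hx
  · rintro (_ | i) y h hy
    · omega
    · simp only [hZ] at hy
      exact hF2 _ _ hy
  · rintro (_ | i) y h hy
    · omega
    · simp only [hZ] at hy
      exact hG2 _ _ hy

theorem no_dec {n : ℕ} (π : Equiv.Perm (Fin n)) (h : ¬ HasDecSeq π 3) (x y z : Fin n)
    (h1 : x < y) (h2 : y < z) (h3 : π y < π x) (h4 : π z < π y) : False := by
  apply h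
  refine ⟨![x, y, z], ?_, ?_⟩
  · rw [Fin.strictMono_iff_lt_succ]
    intro i
    fin_cases i
    · exact h1
    · exact h2
  · rw [Fin.strictAnti_iff_succ_lt]
    intro i
    fin_cases i
    · exact h3
    · exact h4

open Classical in
/-- positions where membership in `S` changes -/
noncomputable def chg {n : ℕ} (S : Finset (Fin n)) : Finset (Fin n) :=
  Finset.univ.filter fun c => ∃ h : (c : ℕ) + 1 < n, ¬ (c ∈ S ↔ (⟨(c : ℕ) + 1, h⟩ : Fin n) ∈ S)

/-- membership determined by a union of intervals cut by few lines, up to a small set -/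
theorem chg_card_le {n : ℕ} (S D : Finset (Fin n)) (A : ℕ → Prop) (P : ℕ → ℕ) (k : ℕ)
    (hA : ∀ c, (∀ i < k, c + 1 ≠ P i) → (A c ↔ A (c + 1)))
    (hS : ∀ x : Fin n, x ∉ D → (x ∈ S ↔ A x.val)) : (chg S).card ≤ k + 2 * D.card := by
  classical
  let E : Finset (Fin n) := Finset.univ.filter (fun c : Fin n => c.val + 1 ∈ (Finset.range k).image P)
  let D' : Finset (Fin n) := Finset.univ.filter (fun c : Fin n => c.val + 1 ∈ D.image Fin.val)
  have hE : E.card ≤ k := by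
    calc E.card ≤ ((Finset.range k).image P).card := by
          apply Finset.card_le_card_of_injOn (fun c => c.val + 1)
          · intro c hc
            simpa [E] using hc
          · intro a _ b _ h
            simp at h
            exact Fin.ext h
      _ ≤ k := by simpa using Finset.card_image_le (s := Finset.range k) (f := P)
  have hD' : D'.card ≤ D.card := by
    calc D'.card ≤ (D.image Fin.val).card := by
          apply Finset.card_le_card_of_injOn (fun c => c.val + 1)
          · intro c hc
            simpa [D'] using hc
          · intro a _ b _ h
            simp at h
            exact Fin.ext h
      _ ≤ _ := Finset.card_image_le
  have hsub : chg S ⊆ E ∪ (D ∪ D') := by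
    intro c hc
    simp only [chg, Finset.mem_filter, Finset.mem_univ, true_and] at hc
    obtain ⟨h, hc⟩ := hc
    by_contra hcon
    simp only [Finset.mem_union, not_or] at hcon
    obtain ⟨h1, h2, h3⟩ := hcon
    apply hc
    rw [hS c h2, hS ⟨c.val + 1, h⟩]
    · apply hA
      intro i hi heq
      apply h1
      simp only [E, Finset.mem_filter, Finset.mem_univ, true_and, Finset.mem_image,
        Finset.mem_range]
      exact ⟨i, hi, heq.symm⟩
    · intro hmem
      apply h3
      simp only [D', Finset.mem_filter, Finset.mem_univ, true_and, Finset.mem_image]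
      exact ⟨_, hmem, rfl⟩
  have := (Finset.card_le_card hsub).trans (Finset.card_union_le _ _)
  have := Finset.card_union_le D D'
  omega

theorem interval_change (P : ℕ → ℕ) (c : ℕ) (I : ℕ → Prop) (a b : ℕ → ℕ) (k : ℕ)
    (hI : ∀ i, I i → a i < k ∧ b i < k) (h : ∀ i < k, c + 1 ≠ P i) :
    (∃ i, I i ∧ P (a i) ≤ c ∧ c < P (b i)) ↔ (∃ i, I i ∧ P (a i) ≤ c + 1 ∧ c + 1 < P (b i)) := by
  constructor
  · rintro ⟨i, hi, h1, h2⟩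
    have := h _ (hI i hi).2
    exact ⟨i, hi, by omega, by omega⟩
  · rintro ⟨i, hi, h1, h2⟩
    have := h _ (hI i hi).1
    exact ⟨i, hi, by omega, by omega⟩

open Classical in
/-- The main combinatorial cut. -/
theorem exists_cut {n : ℕ} (π : Equiv.Perm (Fin n)) (h321 : ¬ HasDecSeq π 3) (x0 x1 : Fin n)
    (hx0 : x0.val = 0) (hx1 : (π x1).val = 0) (hne : x0 ≠ x1) (K : ℕ) (hK : 0 < K) :
    ∃ (S : Finset (Fin n)) (q : ℕ), x0 ∉ S ∧ x1 ∈ S ∧ (∀ x ∈ S, x1 ≤ x) ∧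
      (∀ x, x ∉ S → π x0 ≤ π x) ∧ q * K ≤ n ∧
      (chg S).card ≤ 2 * K + 2 * q ∧ (chg (S.map π.toEmbedding)).card ≤ 2 * K + 2 * q := by
  have e1 : x0.val < x1.val := by
    have : x0.val ≠ x1.val := fun h => hne (Fin.ext h)
    omega
  have e2 : (π x1).val < (π x0).val := by
    have : (π x0).val ≠ (π x1).val := fun h => hne (π.injective (Fin.ext h))
    omega
  obtain ⟨P, V, hP0, hV0, hP1, hV1, mP, mV, hA1, hA2, hB1, hB2⟩ :=
    exists_lines π x1.val (π x0).val x0 x1 e1 le_rfl e2 le_rfl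
  -- no diagonal cells
  have hN : ∀ i (x : Fin n), P i ≤ x.val → x.val < P (i + 1) → V i ≤ (π x).val →
      (π x).val < V (i + 1) → False := by
    intro i x a1 a2 a3 a4
    rcases Nat.eq_zero_or_pos i with rfl | hi
    · simp only [zero_add, hP1, hV1] at a2 a4
      have b1 : x0 ≠ x := by rintro rfl; omega
      have b1' : x0.val ≠ x.val := fun h => b1 (Fin.ext h)
      have b2 : x1 ≠ x := by rintro rfl; omega
      have b2' : (π x1).val ≠ (π x).val := fun h => b2 (π.injective (Fin.ext h))
      exact no_dec π h321 x0 x x1 (by rw [Fin.lt_def]; omega) (by rw [Fin.lt_def]; omega)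
        (by rw [Fin.lt_def]; omega) (by rw [Fin.lt_def]; omega)
    · obtain ⟨y, hy1, hy2⟩ := hB1 i x.val hi a2
      obtain ⟨z, hz1, hz2⟩ := hB2 i (π x).val hi a4
      have b1 : z ≠ x := by rintro rfl; omega
      have b1' : (π z).val ≠ (π x).val := fun h => b1 (π.injective (Fin.ext h))
      have b2 : x ≠ y := by rintro rfl; omega
      have b2' : x.val ≠ y.val := fun h => b2 (Fin.ext h)
      exact no_dec π h321 z x y (by rw [Fin.lt_def]; omega) (by rw [Fin.lt_def]; omega)
        (by rw [Fin.lt_def]; omega) (by rw [Fin.lt_def]; omega)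
  let RowP : ℕ → ℕ → Prop := fun t w => ∃ i, i ≤ t ∧ V (2 * i) ≤ w ∧ w < V (2 * i + 1)
  let ColP : ℕ → ℕ → Prop := fun t w => ∃ i, i < t ∧ P (2 * i + 1) ≤ w ∧ w < P (2 * i + 2)
  -- value band `2 i` is inside position bands `2 i - 1`, `2 i + 1`
  have hF1 : ∀ i (x : Fin n), V (2 * i) ≤ (π x).val → (π x).val < V (2 * i + 1) →
      ColP (i + 1) x.val := by
    intro i x a1 a2
    have a3 := hA1 _ x a2
    by_cases hc : P (2 * i + 1) ≤ x.val
    · exact ⟨i, by omega, hc, a3⟩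
    have a4 : x.val < P (2 * i) := by
      by_contra hcon
      exact hN (2 * i) x (by omega) (by omega) a1 a2
    rcases i with _ | i
    · simp only [mul_zero, hP0] at a4
      omega
    · refine ⟨i, by omega, ?_, a4⟩
      by_contra hcon
      have := hA2 (2 * i + 1) x (by omega)
      rw [show 2 * (i + 1) = 2 * i + 1 + 1 by ring] at a1
      omega
  have hF1' : ∀ i t (x : Fin n), i < t → V (2 * i) ≤ (π x).val → (π x).val < V (2 * i + 1) →
      ColP t x.val := by
    intro i t x hit a1 a2
    obtain ⟨j, hj, h⟩ := hF1 i x a1 a2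
    exact ⟨j, by omega, h⟩
  have hF2 : ∀ t (x : Fin n), ColP t x.val → RowP t (π x).val := by
    rintro t x ⟨i, hi, a1, a2⟩
    have a3 := hA2 _ x a2
    by_cases hc : V (2 * i + 2) ≤ (π x).val
    · exact ⟨i + 1, by omega, hc, a3⟩
    refine ⟨i, by omega, ?_, ?_⟩
    · by_contra hcon
      have := hA1 (2 * i) x (by omega)
      omega
    · by_contra hcon
      exact hN (2 * i + 1) x a1 a2 (by omega) (by rw [show 2 * i + 1 + 1 = 2 * i + 2 by ring]; omega)
  let D : ℕ → Finset (Fin n) := fun t =>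
    Finset.univ.filter fun x => V (2 * t) ≤ (π x).val ∧ (π x).val < V (2 * t + 1)
  have hdisj : ∀ s t, s < t → Disjoint (D s) (D t) := by
    intro s t hst
    rw [Finset.disjoint_left]
    intro x hx hx'
    simp only [D, Finset.mem_filter, Finset.mem_univ, true_and] at hx hx'
    have := mV (show 2 * s + 1 ≤ 2 * t by omega)
    omega
  have hsum : ∑ t ∈ Finset.range K, (D t).card ≤ n := by
    rw [← Finset.card_biUnion]
    · simpa using Finset.card_le_univ ((Finset.range K).biUnion D)
    · intro s _ t _ hst
      rcases lt_or_gt_of_ne hst with h | h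
      · exact hdisj _ _ h
      · exact (hdisj _ _ h).symm
  obtain ⟨t, htK, ht⟩ : ∃ t, t < K ∧ (D t).card * K ≤ n := by
    by_contra! hcon
    have : ∑ t ∈ Finset.range K, n < ∑ t ∈ Finset.range K, (D t).card * K := by
      apply Finset.sum_lt_sum_of_nonempty
      · simpa using hK.ne'
      · intro t ht
        exact hcon t (by simpa using ht)
    rw [← Finset.sum_mul, Finset.sum_const, Finset.card_range, smul_eq_mul, mul_comm] at this
    have := lt_of_mul_lt_mul_right this (Nat.zero_le _)
    omega
  let S : Finset (Fin n) := Finset.univ.filter fun x => RowP t (π x).val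
  have hSge : ∀ x ∈ S, x1 ≤ x := by
    intro x hx
    simp only [S, Finset.mem_filter, Finset.mem_univ, true_and] at hx
    obtain ⟨i, hi, a1, a2⟩ := hx
    obtain ⟨j, _, a3, _⟩ := hF1 i x a1 a2
    have := mP (show 1 ≤ 2 * j + 1 by omega)
    rw [Fin.le_def]
    omega
  refine ⟨S, (D t).card, ?_, ?_, hSge, ?_, ht, ?_, ?_⟩
  · intro h
    have := hSge _ h
    rw [Fin.le_def] at this
    omega
  · simp only [S, Finset.mem_filter, Finset.mem_univ, true_and]
    exact ⟨0, by omega, by simp [hV0], by simp [hV1]; omega⟩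
  · intro x hx
    by_contra hcon
    apply hx
    simp only [S, Finset.mem_filter, Finset.mem_univ, true_and]
    rw [Fin.le_def] at hcon
    exact ⟨0, by omega, by simp [hV0], by simp [hV1]; omega⟩
  · refine (chg_card_le S (D t) (ColP t) P (2 * t + 2) ?_ ?_).trans (by omega)
    · intro c hc
      exact interval_change P c (fun i => i < t) (fun i => 2 * i + 1) (fun i => 2 * i + 2)
        (2 * t + 2) (fun i hi => by omega) hc
    · intro x hx
      simp only [D, S, Finset.mem_filter, Finset.mem_univ, true_and] at hx ⊢
      constructor
      · rintro ⟨i, hi, a1, a2⟩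
        have : i ≠ t := by
          rintro rfl
          exact hx ⟨a1, a2⟩
        exact hF1' i t x (by omega) a1 a2
      · exact hF2 t x
  · have := chg_card_le (S.map π.toEmbedding) ∅ (RowP t) V (2 * t + 2) ?_ ?_
    · simp only [Finset.card_empty] at this
      omega
    · intro c hc
      exact interval_change V c (fun i => i ≤ t) (fun i => 2 * i) (fun i => 2 * i + 1)
        (2 * t + 2) (fun i hi => by omega) hc
    · intro x _
      simp only [S, Finset.mem_map_equiv, Finset.mem_filter, Finset.mem_univ, true_and,
        Equiv.apply_symm_apply]

/-! ### Counting sets with few changes -/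

theorem chg_inj {n : ℕ} (S T : Finset (Fin n)) (h0 : ∀ x : Fin n, x.val = 0 → (x ∈ S ↔ x ∈ T))
    (h : chg S = chg T) : S = T := by
  have key : ∀ (k : ℕ) (hk : k < n), ((⟨k, hk⟩ : Fin n) ∈ S ↔ (⟨k, hk⟩ : Fin n) ∈ T) := by
    intro k
    induction k with
    | zero => intro hk; exact h0 _ rfl
    | succ k ih =>
      intro hk
      have h1 := ih (by omega)
      have h2 : (⟨k, by omega⟩ : Fin n) ∈ chg S ↔ (⟨k, by omega⟩ : Fin n) ∈ chg T := by rw [h]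
      simp only [chg, Finset.mem_filter, Finset.mem_univ, true_and, hk, exists_true_left] at h2
      tauto
  ext x
  exact key x.val x.isLt

open Classical in
/-- sets with few changes -/
noncomputable def Fam (n c K : ℕ) : Finset (Finset (Fin n)) :=
  Finset.univ.filter fun S => ∃ q, q * K ≤ n ∧ (chg S).card ≤ c + 2 * q

theorem Fam_card (n c K : ℕ) (x : ℝ) (hx0 : 0 < x) (hx1 : x < 1)
    (hK : 1 ≤ x ^ 2 * (1 + x) ^ K) : ((Fam n c K).card : ℝ) * x ^ c ≤ 2 * (1 + x) ^ (2 * n) := by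
  classical
  let G : Finset (Finset (Fin n)) :=
    Finset.univ.filter fun A => ∃ q, q * K ≤ n ∧ A.card ≤ c + 2 * q
  have h1 : (Fam n c K).card ≤ 2 * G.card := by
    have : (Fam n c K).card ≤ ((Finset.univ : Finset Bool) ×ˢ G).card := by
      apply Finset.card_le_card_of_injOn
        (fun S => (decide (∃ x ∈ S, x.val = 0), chg S))
      · intro S hS
        simp only [Fam, Finset.coe_filter, Finset.mem_univ, true_and, Set.mem_setOf_eq] at hS
        simpa only [G, Finset.coe_product, Set.mem_prod, Finset.mem_coe, Finset.mem_univ, true_and,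
          Finset.mem_filter] using hS
      · intro S _ T _ hST
        simp only [Prod.mk.injEq, decide_eq_decide] at hST
        refine chg_inj S T ?_ hST.2
        intro y hy
        constructor
        · intro hyS
          obtain ⟨z, hz, hz0⟩ := hST.1.1 ⟨y, hyS, hy⟩
          rwa [show y = z from Fin.ext (by omega)]
        · intro hyS
          obtain ⟨z, hz, hz0⟩ := hST.1.2 ⟨y, hyS, hy⟩
          rwa [show y = z from Fin.ext (by omega)]
    simpa [Finset.card_product] using this
  have h2 : ∀ A ∈ G, x ^ c ≤ x ^ A.card * (1 + x) ^ n := by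
    intro A hA
    simp only [G, Finset.mem_filter, Finset.mem_univ, true_and] at hA
    obtain ⟨q, hq, hA⟩ := hA
    have a1 : x ^ (c + 2 * q) ≤ x ^ A.card := pow_le_pow_of_le_one hx0.le hx1.le hA
    have a2 : (1 + x) ^ (q * K) ≤ (1 + x) ^ n := pow_le_pow_right₀ (by linarith) hq
    have a3 : (1 : ℝ) ≤ (x ^ 2 * (1 + x) ^ K) ^ q := one_le_pow₀ hK
    calc x ^ c = x ^ c * 1 := by ring
      _ ≤ x ^ c * (x ^ 2 * (1 + x) ^ K) ^ q := by gcongr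
      _ = x ^ (c + 2 * q) * (1 + x) ^ (q * K) := by
          rw [mul_pow, ← pow_mul, ← pow_mul, pow_add, mul_comm K q]; ring
      _ ≤ _ := by gcongr
  have h3 : ∑ A : Finset (Fin n), x ^ A.card = (1 + x) ^ n := by
    have := Finset.sum_pow_mul_eq_add_pow x 1 (Finset.univ : Finset (Fin n))
    simp only [one_pow, mul_one, Finset.powerset_univ, Finset.card_univ, Fintype.card_fin] at this
    rw [this, add_comm]
  have h4 : (G.card : ℝ) * x ^ c ≤ (1 + x) ^ n * (1 + x) ^ n := by
    calc (G.card : ℝ) * x ^ c = ∑ A ∈ G, x ^ c := by simp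
      _ ≤ ∑ A ∈ G, x ^ A.card * (1 + x) ^ n := Finset.sum_le_sum h2
      _ = (∑ A ∈ G, x ^ A.card) * (1 + x) ^ n := by rw [Finset.sum_mul]
      _ ≤ (∑ A : Finset (Fin n), x ^ A.card) * (1 + x) ^ n := by
          gcongr
          · exact Finset.subset_univ _
      _ = _ := by rw [h3]
  have h5 : ((Fam n c K).card : ℝ) ≤ 2 * G.card := by exact_mod_cast h1
  calc ((Fam n c K).card : ℝ) * x ^ c ≤ (2 * G.card) * x ^ c := by gcongr
    _ = 2 * (G.card * x ^ c) := by ring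
    _ ≤ 2 * ((1 + x) ^ n * (1 + x) ^ n) := by gcongr
    _ = _ := by rw [two_mul n, pow_add]

/-! ### Standardisation -/

theorem card_eq_of_iff {n : ℕ} {π : Equiv.Perm (Fin n)} {S V : Finset (Fin n)}
    (h : ∀ x, x ∈ S ↔ π x ∈ V) : V.card = S.card := by
  have : V = S.map π.toEmbedding := by
    ext y
    rw [Finset.mem_map_equiv, h, Equiv.apply_symm_apply]
  rw [this, Finset.card_map]

/-- the pattern of `π` on the positions in `S` -/
noncomputable def stdz {n : ℕ} (π : Equiv.Perm (Fin n)) (S V : Finset (Fin n))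
    (h : ∀ x, x ∈ S ↔ π x ∈ V) : Equiv.Perm (Fin S.card) :=
  (S.orderIsoOfFin rfl).toEquiv.trans
    ((π.subtypeEquiv h).trans (V.orderIsoOfFin (card_eq_of_iff h)).symm.toEquiv)

theorem stdz_spec {n : ℕ} (π : Equiv.Perm (Fin n)) (S V : Finset (Fin n))
    (h : ∀ x, x ∈ S ↔ π x ∈ V) (i : Fin S.card) :
    V.orderEmbOfFin (card_eq_of_iff h) (stdz π S V h i) = π (S.orderEmbOfFin rfl i) := by
  rw [← Finset.coe_orderIsoOfFin_apply, ← Finset.coe_orderIsoOfFin_apply]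
  simp [stdz]

theorem stdz_emb {n : ℕ} (π : Equiv.Perm (Fin n)) (S V : Finset (Fin n))
    (h : ∀ x, x ∈ S ↔ π x ∈ V) : IsEmbedding (stdz π S V h) π (S.orderEmbOfFin rfl) := by
  refine ⟨(S.orderEmbOfFin rfl).strictMono, ?_⟩
  intro a b
  rw [← stdz_spec π S V h, ← stdz_spec π S V h]
  simp

theorem stdz_inj {n : ℕ} (π π' : Equiv.Perm (Fin n)) (S V : Finset (Fin n))
    (h : ∀ x, x ∈ S ↔ π x ∈ V) (h' : ∀ x, x ∈ S ↔ π' x ∈ V)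
    (heq : stdz π S V h = stdz π' S V h') (x : Fin n) (hx : x ∈ S) : π x = π' x := by
  obtain ⟨i, rfl⟩ : x ∈ Set.range (S.orderEmbOfFin rfl) := by simpa using hx
  rw [← stdz_spec π S V h, ← stdz_spec π' S V h', heq]

/-- permutations `1 ⊕ τ` with `τ` in the class avoiding `β` (and the empty permutation) -/
def DCl (X : Set PermSig) (β : PermSig) : Set PermSig :=
  {σ | σ ∈ IkClass 2 ∩ AvClass X ∧ ∀ h : 0 < σ.1, σ.2 ⟨0, h⟩ = ⟨0, h⟩ ∧
    ¬ ∃ f, IsEmbedding β.2 σ.2 f ∧ ∀ i, 0 < (f i).val}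

theorem count_DCl_zero (X : Set PermSig) (β : PermSig) : classCount (DCl X β) 0 ≤ 1 := by
  unfold classCount
  exact Finite.card_le_one_iff_subsingleton.2 inferInstance

theorem decomposeFin_fst {a : ℕ} (ρ : Equiv.Perm (Fin (a + 1))) (hρ : ρ 0 = 0) :
    (Equiv.Perm.decomposeFin ρ).1 = 0 := by
  have e : ρ = Equiv.Perm.decomposeFin.symm
      ((Equiv.Perm.decomposeFin ρ).1, (Equiv.Perm.decomposeFin ρ).2) := by simp
  have := congrArg (fun f : Equiv.Perm (Fin (a + 1)) => f 0) e
  simp only [Equiv.Perm.decomposeFin_symm_apply_zero] at this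
  rw [← this, hρ]

theorem count_DCl_succ (X : Set PermSig) (β : PermSig) (a : ℕ) :
    classCount (DCl X β) (a + 1) ≤ classCount (IkClass 2 ∩ AvClass X ∩ AvClass {β}) a := by
  unfold classCount
  have key : ∀ σ : Equiv.Perm (Fin (a + 1)), (⟨a + 1, σ⟩ : PermSig) ∈ DCl X β →
      σ 0 = 0 ∧ IsEmbedding (Equiv.Perm.decomposeFin σ).2 σ Fin.succ := by
    intro σ hσ
    have h0 : σ 0 = 0 := (hσ.2 (Nat.succ_pos a)).1
    refine ⟨h0, Fin.strictMono_succ, ?_⟩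
    have h1 : ∀ i : Fin a, σ i.succ = ((Equiv.Perm.decomposeFin σ).2 i).succ := by
      intro i
      have e : σ = Equiv.Perm.decomposeFin.symm (0, (Equiv.Perm.decomposeFin σ).2) := by
        rw [← decomposeFin_fst σ h0]
        simp
      have := congrArg (fun f : Equiv.Perm (Fin (a + 1)) => f i.succ) e
      simp only [Equiv.Perm.decomposeFin_symm_apply_succ, Equiv.swap_self, Equiv.refl_apply] at this
      exact this
    intro i j
    rw [h1, h1]
    simp
  refine Nat.card_le_card_of_injective
    (fun σ : {π : Equiv.Perm (Fin (a + 1)) // (⟨a + 1, π⟩ : PermSig) ∈ DCl X β} =>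
      (⟨(Equiv.Perm.decomposeFin σ.1).2, ?_⟩ : {π : Equiv.Perm (Fin a) //
        (⟨a, π⟩ : PermSig) ∈ IkClass 2 ∩ AvClass X ∩ AvClass {β}})) ?_
  · have hk := key σ.1 σ.2
    have hinv : Involves ⟨a, (Equiv.Perm.decomposeFin σ.1).2⟩ ⟨a + 1, σ.1⟩ := ⟨_, hk.2⟩
    refine ⟨⟨isPatternClass_Ik 2 _ _ hinv σ.2.1.1, isPatternClass_Av X _ _ hinv σ.2.1.2⟩, ?_⟩
    intro α hα hinv2
    rw [Set.mem_singleton_iff] at hα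
    subst hα
    obtain ⟨f, hf⟩ := hinv2
    exact (σ.2.2 (Nat.succ_pos a)).2 ⟨_, hf.trans' hk.2, fun i => by simp⟩
  · intro σ τ h
    have h2 : (Equiv.Perm.decomposeFin σ.1).2 = (Equiv.Perm.decomposeFin τ.1).2 :=
      congrArg Subtype.val h
    have h0 := (key σ.1 σ.2).1
    have h0' := (key τ.1 τ.2).1
    apply Subtype.ext
    apply Equiv.Perm.decomposeFin.injective
    exact Prod.ext (by rw [decomposeFin_fst _ h0, decomposeFin_fst _ h0']) h2

theorem stdz_mem_DCl (X : Set PermSig) (β : PermSig) {n : ℕ} (π : Equiv.Perm (Fin n))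
    (hπ : (⟨n, π⟩ : PermSig) ∈ IkClass 2 ∩ AvClass X ∩ AvClass {DSum (iotaSig 1) β})
    (S V : Finset (Fin n)) (h : ∀ x, x ∈ S ↔ π x ∈ V)
    (hm : S = ∅ ∨ ∃ m ∈ S, ∀ x ∈ S, m ≤ x ∧ π m ≤ π x) :
    (⟨S.card, stdz π S V h⟩ : PermSig) ∈ DCl X β := by
  have he := stdz_emb π S V h
  have hinv : Involves ⟨S.card, stdz π S V h⟩ ⟨n, π⟩ := ⟨_, he⟩
  refine ⟨⟨isPatternClass_Ik 2 _ _ hinv hπ.1.1, isPatternClass_Av X _ _ hinv hπ.1.2⟩, ?_⟩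
  rcases hm with rfl | ⟨m, hmS, hm⟩
  · intro h
    simp at h
  intro hpos
  change 0 < S.card at hpos
  have hS0 : S.orderEmbOfFin rfl ⟨0, hpos⟩ = m := by
    obtain ⟨i, hi⟩ : m ∈ Set.range (S.orderEmbOfFin rfl) := by simpa using hmS
    apply le_antisymm
    · rw [← hi]
      apply (S.orderEmbOfFin rfl).monotone
      rw [Fin.le_def]
      exact Nat.zero_le _
    · exact (hm _ (S.orderEmbOfFin_mem rfl _)).1
  constructor
  · change stdz π S V h ⟨0, hpos⟩ = ⟨0, hpos⟩
    by_contra hcon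
    obtain ⟨j, hj⟩ := (stdz π S V h).surjective ⟨0, hpos⟩
    have hlt : stdz π S V h j < stdz π S V h ⟨0, hpos⟩ := by
      rw [hj]
      rw [Fin.lt_def]
      have : (stdz π S V h ⟨0, hpos⟩).val ≠ 0 := fun hh => hcon (Fin.ext hh)
      change 0 < _
      omega
    rw [he.2, hS0] at hlt
    exact absurd hlt ((hm _ (S.orderEmbOfFin_mem rfl _)).2).not_gt
  · rintro ⟨f, hf, hf0⟩
    refine hπ.2 _ (Set.mem_singleton _) (involves_oneSum β π _ (hf.trans' he) m ?_ ?_)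
    · intro i
      rw [← hS0]
      exact he.1 (by rw [Fin.lt_def]; exact hf0 i)
    · intro i
      refine lt_of_le_of_ne (hm _ (S.orderEmbOfFin_mem rfl _)).2 ?_
      intro heq
      have := π.injective heq
      rw [← hS0] at this
      have := (S.orderEmbOfFin rfl).injective this
      have h3 := hf0 i
      rw [← this] at h3
      exact absurd h3 (lt_irrefl _)

theorem compl_iff {n : ℕ} {π : Equiv.Perm (Fin n)} {S V : Finset (Fin n)}
    (h : ∀ x, x ∈ S ↔ π x ∈ V) : ∀ x, x ∈ Sᶜ ↔ π x ∈ Vᶜ := by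
  intro x
  simp [h]

/-- `π` splits along `S`, `V` into two members of `DCl`. -/
def Splits' (X : Set PermSig) (β : PermSig) {n : ℕ} (S V : Finset (Fin n))
    (π : Equiv.Perm (Fin n)) : Prop :=
  ∃ h : ∀ x, x ∈ S ↔ π x ∈ V, (⟨S.card, stdz π S V h⟩ : PermSig) ∈ DCl X β ∧
    (⟨Sᶜ.card, stdz π Sᶜ Vᶜ (compl_iff h)⟩ : PermSig) ∈ DCl X β

theorem card_splits (X : Set PermSig) (β : PermSig) {n : ℕ} (S V : Finset (Fin n)) :
    Nat.card {π // Splits' X β S V π} ≤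
      classCount (DCl X β) S.card * classCount (DCl X β) Sᶜ.card := by
  unfold classCount
  rw [← Nat.card_prod]
  refine Nat.card_le_card_of_injective
    (fun π : {π // Splits' X β S V π} =>
      (⟨⟨stdz π.1 S V π.2.1, π.2.2.1⟩, ⟨stdz π.1 Sᶜ Vᶜ (compl_iff π.2.1), π.2.2.2⟩⟩ :
        {π : Equiv.Perm (Fin S.card) // (⟨S.card, π⟩ : PermSig) ∈ DCl X β} ×
        {π : Equiv.Perm (Fin Sᶜ.card) // (⟨Sᶜ.card, π⟩ : PermSig) ∈ DCl X β})) ?_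
  intro π π' heq
  simp only [Prod.mk.injEq, Subtype.mk.injEq] at heq
  apply Subtype.ext
  ext x
  by_cases hx : x ∈ S
  · rw [stdz_inj _ _ _ _ _ _ heq.1 x hx]
  · rw [stdz_inj _ _ _ _ _ _ heq.2 x (by simpa using hx)]

theorem exists_split (X : Set PermSig) (β : PermSig) {n : ℕ} (hn : 0 < n)
    (π : Equiv.Perm (Fin n))
    (hπ : (⟨n, π⟩ : PermSig) ∈ IkClass 2 ∩ AvClass X ∩ AvClass {DSum (iotaSig 1) β})
    (K : ℕ) (hK : 0 < K) :
    ∃ S V, S ∈ Fam n (2 * K) K ∧ V ∈ Fam n (2 * K) K ∧ Splits' X β S V π := by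
  classical
  let x0 : Fin n := ⟨0, hn⟩
  let x1 : Fin n := π.symm ⟨0, hn⟩
  have hx1 : π x1 = ⟨0, hn⟩ := by simp [x1]
  by_cases hne : x0 = x1
  · have hu : (Finset.univ : Finset (Fin n)) ∈ Fam n (2 * K) K := by
      simp only [Fam, Finset.mem_filter, Finset.mem_univ, true_and]
      refine ⟨0, by omega, ?_⟩
      simp [chg]
    refine ⟨Finset.univ, Finset.univ, hu, hu, by simp, ?_, ?_⟩
    · apply stdz_mem_DCl X β π hπ
      right
      refine ⟨x0, Finset.mem_univ _, fun x _ => ⟨?_, ?_⟩⟩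
      · rw [Fin.le_def]; exact Nat.zero_le _
      · rw [hne, hx1, Fin.le_def]; exact Nat.zero_le _
    · apply stdz_mem_DCl X β π hπ
      left
      simp
  · obtain ⟨S, q, h0, h1, hS, hT, hq, hc1, hc2⟩ :=
      exists_cut π hπ.1.1 x0 x1 rfl (by rw [hx1]) hne K hK
    refine ⟨S, S.map π.toEmbedding, ?_, ?_, ?_, ?_, ?_⟩
    · simp only [Fam, Finset.mem_filter, Finset.mem_univ, true_and]
      exact ⟨q, hq, hc1⟩
    · simp only [Fam, Finset.mem_filter, Finset.mem_univ, true_and]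
      exact ⟨q, hq, hc2⟩
    · intro x
      simp
    · apply stdz_mem_DCl X β π hπ
      right
      refine ⟨x1, h1, fun x hx => ⟨hS x hx, ?_⟩⟩
      rw [hx1, Fin.le_def]; exact Nat.zero_le _
    · apply stdz_mem_DCl X β π hπ
      right
      refine ⟨x0, by simpa using h0, fun x hx => ⟨?_, hT x (by simpa using hx)⟩⟩
      rw [Fin.le_def]; exact Nat.zero_le _

theorem count_bound (X : Set PermSig) (β : PermSig) (M l : ℝ) (hl : 0 < l)
    (hM : ∀ a, (classCount (DCl X β) a : ℝ) ≤ M * l ^ a) {n : ℕ} (hn : 0 < n)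
    (K : ℕ) (hK : 0 < K) :
    (classCount (IkClass 2 ∩ AvClass X ∩ AvClass {DSum (iotaSig 1) β}) n : ℝ) ≤
      ((Fam n (2 * K) K).card : ℝ) ^ 2 * (M ^ 2 * l ^ n) := by
  classical
  set F := Fam n (2 * K) K with hF
  let E : Finset (Fin n) × Finset (Fin n) → Finset (Equiv.Perm (Fin n)) := fun q =>
    Finset.univ.filter fun π => Splits' X β q.1 q.2 π
  have hE : ∀ q, ((E q).card : ℝ) ≤ M ^ 2 * l ^ n := by
    intro q
    have h1 := card_splits X β q.1 q.2
    rw [Nat.card_eq_fintype_card, Fintype.card_subtype] at h1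
    have h2 : ((E q).card : ℝ) ≤ (classCount (DCl X β) q.1.card : ℝ) *
        (classCount (DCl X β) (q.1)ᶜ.card : ℝ) := by exact_mod_cast h1
    have hc : q.1.card + (q.1)ᶜ.card = n := by simp [Finset.card_add_card_compl]
    calc ((E q).card : ℝ) ≤ _ := h2
      _ ≤ (M * l ^ q.1.card) * (M * l ^ (q.1)ᶜ.card) :=
          mul_le_mul (hM _) (hM _) (Nat.cast_nonneg _) ((Nat.cast_nonneg _).trans (hM _))
      _ = M ^ 2 * l ^ (q.1.card + (q.1)ᶜ.card) := by rw [pow_add]; ring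
      _ = _ := by rw [hc]
  have hsub : (Finset.univ.filter fun π : Equiv.Perm (Fin n) =>
      (⟨n, π⟩ : PermSig) ∈ IkClass 2 ∩ AvClass X ∩ AvClass {DSum (iotaSig 1) β}) ⊆
      (F ×ˢ F).biUnion E := by
    intro π hπ
    simp only [Finset.mem_filter, Finset.mem_univ, true_and] at hπ
    obtain ⟨S, V, hS, hV, hsp⟩ := exists_split X β hn π hπ K hK
    rw [Finset.mem_biUnion]
    exact ⟨(S, V), Finset.mem_product.2 ⟨hS, hV⟩, by simpa [E] using hsp⟩
  have h3 := (Finset.card_le_card hsub).trans Finset.card_biUnion_le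
  unfold classCount
  rw [Nat.card_eq_fintype_card, Fintype.card_subtype]
  calc _ ≤ ((∑ q ∈ F ×ˢ F, (E q).card : ℕ) : ℝ) := by exact_mod_cast h3
    _ = ∑ q ∈ F ×ˢ F, ((E q).card : ℝ) := by push_cast; rfl
    _ ≤ ∑ q ∈ F ×ˢ F, M ^ 2 * l ^ n := Finset.sum_le_sum fun q _ => hE q
    _ = _ := by
        rw [Finset.sum_const, Finset.card_product, nsmul_eq_mul]
        push_cast
        ring

/-! ### Growth rates -/

theorem growth_bound (C : Set PermSig) (l : ℝ) (hl : 0 < l)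
    (h : growthRate C < ENNReal.ofReal l) :
    ∃ M : ℝ, ∀ n, (classCount C n : ℝ) ≤ M * l ^ n := by
  have h1 : ∀ᶠ n : ℕ in atTop, (classCount C n : ENNReal) ^ (1 / (n : ℝ)) < ENNReal.ofReal l :=
    Filter.eventually_lt_of_limsup_lt h
  obtain ⟨N, hN⟩ := Filter.eventually_atTop.1 h1
  refine ⟨1 + ∑ n ∈ Finset.range (N + 1), (classCount C n : ℝ) / l ^ n, fun n => ?_⟩
  have hnn : 0 ≤ ∑ n ∈ Finset.range (N + 1), (classCount C n : ℝ) / l ^ n :=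
    Finset.sum_nonneg fun n _ => by positivity
  by_cases hn : n ∈ Finset.range (N + 1)
  · have := Finset.single_le_sum (f := fun n => (classCount C n : ℝ) / l ^ n)
      (fun n _ => by positivity) hn
    rw [← div_le_iff₀ (by positivity)]
    linarith
  · simp only [Finset.mem_range, not_lt] at hn
    have h2 := hN n (by omega)
    have hn0 : (0 : ℝ) < n := by exact_mod_cast (by omega : 0 < n)
    have h3 := ENNReal.rpow_lt_rpow h2 hn0
    rw [← ENNReal.rpow_mul, one_div, inv_mul_cancel₀ hn0.ne', ENNReal.rpow_one,
      ENNReal.rpow_natCast, ← ENNReal.ofReal_pow hl.le, ← ENNReal.ofReal_natCast,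
      ENNReal.ofReal_lt_ofReal_iff (by positivity)] at h3
    have : 0 < l ^ n := by positivity
    nlinarith

theorem growth_le (C : Set PermSig) (M l l' : ℝ) (hl : 0 < l) (hll : l < l') (n0 : ℕ)
    (h : ∀ n, n0 ≤ n → (classCount C n : ℝ) ≤ M * l ^ n) :
    growthRate C ≤ ENNReal.ofReal l' := by
  have hl' : 0 < l' := hl.trans hll
  obtain ⟨m, hm⟩ := pow_unbounded_of_one_lt M ((one_lt_div hl).2 hll)
  refine Filter.limsup_le_of_le (by isBoundedDefault) ?_
  filter_upwards [Filter.eventually_ge_atTop (n0 + m + 1)] with n hn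
  have hn0 : (0 : ℝ) < n := by exact_mod_cast (by omega : 0 < n)
  have h1 : (classCount C n : ℝ) ≤ l' ^ n := by
    have a : M ≤ (l' / l) ^ n :=
      hm.le.trans (pow_le_pow_right₀ ((one_lt_div hl).2 hll).le (by omega))
    calc (classCount C n : ℝ) ≤ M * l ^ n := h n (by omega)
      _ ≤ (l' / l) ^ n * l ^ n := by gcongr
      _ = l' ^ n := by rw [← mul_pow, div_mul_cancel₀ _ hl.ne']
  rw [one_div, ENNReal.rpow_inv_le_iff hn0, ENNReal.rpow_natCast, ← ENNReal.ofReal_pow hl'.le,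
    ← ENNReal.ofReal_natCast]
  exact ENNReal.ofReal_le_ofReal h1

theorem growth_mono {C C' : Set PermSig} (h : C ⊆ C') : growthRate C ≤ growthRate C' := by
  unfold growthRate
  apply Filter.limsup_le_limsup
  · filter_upwards with n
    apply ENNReal.rpow_le_rpow _ (by positivity)
    have : classCount C n ≤ classCount C' n :=
      Nat.card_le_card_of_injective (fun π => ⟨π.1, h π.2⟩)
        (fun a b hab => Subtype.ext (congrArg (fun z => z.1) hab))
    exact_mod_cast this
  · isBoundedDefault
  · isBoundedDefault

theorem growth_main (X : Set PermSig) (β : PermSig) (l x : ℝ) (hl : 0 < l) (hx0 : 0 < x)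
    (hx1 : x < 1)
    (h : growthRate (IkClass 2 ∩ AvClass X ∩ AvClass {β}) < ENNReal.ofReal l) :
    growthRate (IkClass 2 ∩ AvClass X ∩ AvClass {DSum (iotaSig 1) β}) ≤
      ENNReal.ofReal ((1 + x) ^ 5 * l) := by
  obtain ⟨M0, hM0⟩ := growth_bound _ l hl h
  obtain ⟨K, hK⟩ := pow_unbounded_of_one_lt (1 / x ^ 2) (show 1 < 1 + x by linarith)
  have hxx : 0 < x ^ 2 := by positivity
  have hK1 : 1 ≤ x ^ 2 * (1 + x) ^ K := by
    rw [div_lt_iff₀ hxx] at hK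
    linarith
  have hKpos : 0 < K := by
    rcases Nat.eq_zero_or_pos K with rfl | h
    · simp only [pow_zero, mul_one] at hK1
      nlinarith
    · exact h
  set M : ℝ := max 1 (M0 / l) with hMdef
  have hM : ∀ a, (classCount (DCl X β) a : ℝ) ≤ M * l ^ a := by
    rintro (_ | a)
    · have : (classCount (DCl X β) 0 : ℝ) ≤ 1 := by exact_mod_cast count_DCl_zero X β
      rw [pow_zero, mul_one]
      exact this.trans (le_max_left _ _)
    · have h1 : (classCount (DCl X β) (a + 1) : ℝ) ≤
          classCount (IkClass 2 ∩ AvClass X ∩ AvClass {β}) a := by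
        exact_mod_cast count_DCl_succ X β a
      calc _ ≤ _ := h1
        _ ≤ M0 * l ^ a := hM0 a
        _ = (M0 / l) * l ^ (a + 1) := by rw [pow_succ]; field_simp
        _ ≤ M * l ^ (a + 1) := by
            gcongr
            exact le_max_right _ _
  refine growth_le _ ((2 / x ^ (2 * K)) ^ 2 * M ^ 2) ((1 + x) ^ 4 * l) _ (by positivity) ?_ 1 ?_
  · gcongr <;> first | linarith | norm_num
  · intro n hn
    refine (count_bound X β M l hl hM hn K hKpos).trans ?_
    have hF := Fam_card n (2 * K) K x hx0 hx1 hK1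
    have hF' : ((Fam n (2 * K) K).card : ℝ) ≤ 2 / x ^ (2 * K) * (1 + x) ^ (2 * n) := by
      rw [div_mul_eq_mul_div, le_div_iff₀ (by positivity)]
      exact hF
    calc ((Fam n (2 * K) K).card : ℝ) ^ 2 * (M ^ 2 * l ^ n)
        ≤ (2 / x ^ (2 * K) * (1 + x) ^ (2 * n)) ^ 2 * (M ^ 2 * l ^ n) := by gcongr
      _ = _ := by
          rw [mul_pow, mul_pow ((1 + x) ^ 4), ← pow_mul, ← pow_mul]
          rw [show 2 * n * 2 = 4 * n by ring]
          ring

/-- If `X ⊆ I₂`, `β ∈ I₂ ∩ Av(X)` and `C = I₂ ∩ Av(X) ∩ Av(β)` is infinite, then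
`C` and `C' = I₂ ∩ Av(X) ∩ Av(1 ⊕ β)` have the same growth rate. -/
theorem growthRate_av_oneSum (X : Set PermSig) (hX : X ⊆ IkClass 2)
    (β : PermSig) (hβ : β ∈ IkClass 2 ∩ AvClass X)
    (hinf : (IkClass 2 ∩ AvClass X ∩ AvClass {β}).Infinite) :
    growthRate (IkClass 2 ∩ AvClass X ∩ AvClass {β}) =
      growthRate (IkClass 2 ∩ AvClass X ∩ AvClass {DSum (iotaSig 1) β}) := by
  apply le_antisymm
  · apply growth_mono
    rintro π ⟨h1, h2⟩
    refine ⟨h1, ?_⟩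
    intro α hα hinv
    rw [Set.mem_singleton_iff] at hα
    subst hα
    exact h2 β (Set.mem_singleton _) ((involves_dsum_right _ _).trans' hinv)
  · apply le_of_forall_gt_imp_ge_of_dense
    intro r hr
    obtain ⟨s, hs1, hs2⟩ := ENNReal.lt_iff_exists_nnreal_btwn.1 hr
    have hs0 : (0 : ℝ) < s := by
      have : (0 : ENNReal) < s := lt_of_le_of_lt zero_le hs1
      exact_mod_cast this
    have hgr := fun x hx0 hx1 => growth_main X β s x hs0 hx0 hx1 (by simpa using hs1)
    have hcont : Tendsto (fun x : ℝ => ENNReal.ofReal ((1 + x) ^ 5 * s)) (nhdsWithin 0 (Set.Ioi 0))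
        (nhds (ENNReal.ofReal ((1 + 0) ^ 5 * s))) := by
      apply (Continuous.tendsto _ 0).mono_left nhdsWithin_le_nhds
      exact ENNReal.continuous_ofReal.comp (by fun_prop)
    have hlim : growthRate (IkClass 2 ∩ AvClass X ∩ AvClass {DSum (iotaSig 1) β}) ≤
        ENNReal.ofReal ((1 + 0) ^ 5 * s) := by
      apply ge_of_tendsto hcont
      filter_upwards [Ioo_mem_nhdsGT (show (0 : ℝ) < 1 by norm_num)] with x hx
      exact hgr x hx.1 hx.2
    refine hlim.trans (le_trans ?_ hs2.le)
    simp
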